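/- arXiv:2105.07765 — 2 statements merged into one kernel-verified Lean document; each statement's English description precedes it below -/
import Mathlib

section
/- Let p ≥ 1 be an integer, T : ℝ^n → ℝ be continuously differentiable, σ > 0, and define m(s) := T(s) + (σ/(p+1)!) N(s)^{p+1}. If s* is a local minimizer of m, then ‖∇T(s*)‖_{N,1} = (σ/p!) N(s*)^p. -/
open scoped RealInnerProductSpace

noncomputable section

/-- Abbreviation for the Euclidean space `ℝ^n`. -/
abbrev E (n : ℕ) := EuclideanSpace ℝ (Fin n)

/-- `N` is a norm on `ℝ^n` (possibly non-smooth, e.g. `ℓ¹` or `ℓ∞`). -/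
structure IsNorm (n : ℕ) (N : E n → ℝ) : Prop where
  add_le : ∀ x y, N (x + y) ≤ N x + N y
  smul : ∀ (c : ℝ) (x : E n), N (c • x) = |c| * N x
  eq_zero : ∀ x, N x = 0 → x = 0

/-- The dual norm `‖v‖_{N,1} := max_{N s = 1} ⟪v, s⟫`. -/
def dualNorm (n : ℕ) (N : E n → ℝ) (v : E n) : ℝ :=
  sSup {t : ℝ | ∃ s, N s = 1 ∧ t = ⟪v, s⟫}

open Filter Topology in
/-- A function with a one-sided minimum at `a` has nonnegative derivative there. -/
theorem HasDerivAt.nonneg_of_eventually_ge_right {f : ℝ → ℝ} {f' a : ℝ} (hf : HasDerivAt f f' a)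
    (h : ∀ᶠ t in 𝓝[>] a, f a ≤ f t) : 0 ≤ f' := by
  have ht := hasDerivWithinAt_iff_tendsto_slope' (s := Set.Ioi a) (by simp) |>.1
    hf.hasDerivWithinAt
  refine ge_of_tendsto ht ?_
  filter_upwards [h, self_mem_nhdsWithin] with t hle hlt
  rw [slope_def_field]
  exact div_nonneg (sub_nonneg.2 hle) (sub_nonneg.2 (le_of_lt hlt))

namespace IsNorm

variable {n : ℕ} {N : E n → ℝ}

theorem map_neg (hN : IsNorm n N) (x : E n) : N (-x) = N x := by
  simpa using hN.smul (-1) x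

theorem map_zero (hN : IsNorm n N) : N 0 = 0 := by
  simpa using hN.smul 0 0

theorem nonneg (hN : IsNorm n N) (x : E n) : 0 ≤ N x := by
  have h := hN.add_le x (-x)
  rw [add_neg_cancel, hN.map_zero, hN.map_neg] at h
  linarith

theorem pos (hN : IsNorm n N) {x : E n} (hx : x ≠ 0) : 0 < N x :=
  (hN.nonneg x).lt_of_ne' fun h => hx (hN.eq_zero x h)

theorem map_inv_smul_self (hN : IsNorm n N) {x : E n} (hx : x ≠ 0) : N ((N x)⁻¹ • x) = 1 := by
  rw [hN.smul, abs_of_pos (inv_pos.2 (hN.pos hx)), inv_mul_cancel₀ (hN.pos hx).ne']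

end IsNorm

open Filter Topology in
/-- First-order condition for a local minimizer of `T + σ/(p+1)! N^(p+1)` along a direction `d` in
which `N` grows at rate at most `b`. -/
theorem IsLocalMin.inner_gradient_add_nonneg {n : ℕ} {N : E n → ℝ} (hN : IsNorm n N) {p : ℕ}
    {T : E n → ℝ} {σ : ℝ} (hσ : 0 < σ) {x : E n} (hT : DifferentiableAt ℝ T x)
    (hmin : IsLocalMin (fun t => T t + σ / ((p + 1).factorial : ℝ) * N t ^ (p + 1)) x)
    {d : E n} {b : ℝ} (hb : ∀ᶠ t : ℝ in 𝓝[>] 0, N (x + t • d) ≤ N x + t * b) :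
    0 ≤ ⟪gradient T x, d⟫ + σ / (p.factorial : ℝ) * N x ^ p * b := by
  have hline : HasDerivAt (fun t : ℝ => x + t • d) d 0 := by
    simpa using ((hasDerivAt_id (0 : ℝ)).smul_const d).const_add x
  have hT' : HasDerivAt (fun t : ℝ => T (x + t • d)) ⟪gradient T x, d⟫ 0 := by
    have h := hT.hasGradientAt.hasFDerivAt
    have h0 : x = x + (0 : ℝ) • d := by simp
    rw [h0] at h
    have h1 := h.comp_hasDerivAt (0 : ℝ) hline
    simpa [Function.comp_def] using h1
  have hpow : HasDerivAt (fun t : ℝ => (N x + t * b) ^ (p + 1)) ((p + 1) * N x ^ p * b) 0 := by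
    have h := ((((hasDerivAt_id (0 : ℝ)).mul_const b).const_add (N x)).fun_pow (p + 1))
    simpa using h
  have hder := hT'.add (hpow.const_mul (σ / ((p + 1).factorial : ℝ)))
  have hnn := hder.nonneg_of_eventually_ge_right (by
    have htend : Tendsto (fun t : ℝ => x + t • d) (𝓝[>] 0) (𝓝 x) := by
      have h := hline.continuousAt.tendsto
      simp only [zero_smul, add_zero] at h
      exact h.mono_left nhdsWithin_le_nhds
    filter_upwards [hb, htend.eventually hmin] with t hbt hmt
    have hle : σ / ((p + 1).factorial : ℝ) * N (x + t • d) ^ (p + 1)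
        ≤ σ / ((p + 1).factorial : ℝ) * (N x + t * b) ^ (p + 1) := by
      have := hN.nonneg (x + t • d)
      gcongr
    simp only [Pi.add_apply, zero_smul, add_zero, zero_mul]
    linarith)
  convert hnn using 2
  rw [Nat.factorial_succ]
  push_cast
  field_simp

/-- if `s*` is a local minimizer of
`m(s) = T(s) + (σ/(p+1)!) N(s)^{p+1}` with `T` continuously differentiable,
then `‖∇T(s*)‖_{N,1} = (σ/p!) N(s*)^p`. -/
theorem stmt2 {n : ℕ} (hn : 1 ≤ n) (N : E n → ℝ) (hN : IsNorm n N)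
    (p : ℕ) (hp : 1 ≤ p) (T : E n → ℝ) (hT : ContDiff ℝ 1 T)
    (σ : ℝ) (hσ : 0 < σ) (sstar : E n)
    (hmin : IsLocalMin (fun t => T t + σ / ((p + 1).factorial : ℝ) * N t ^ (p + 1)) sstar) :
    dualNorm n N (gradient T sstar) = σ / (p.factorial : ℝ) * N sstar ^ p := by
  have hd : DifferentiableAt ℝ T sstar := hT.differentiable one_ne_zero sstar
  have upper : ∀ s, ⟪gradient T sstar, s⟫ ≤ σ / (p.factorial : ℝ) * N sstar ^ p * N s := by
    intro s
    have h := hmin.inner_gradient_add_nonneg hN hσ hd (d := -s) (b := N s) (by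
      filter_upwards [self_mem_nhdsWithin] with t ht
      refine (hN.add_le _ _).trans_eq ?_
      rw [hN.smul, hN.map_neg, abs_of_pos ht])
    rw [inner_neg_right] at h
    linarith
  refine IsGreatest.csSup_eq ⟨?_, ?_⟩
  · by_cases hs : sstar = 0
    · have : Nonempty (Fin n) := ⟨⟨0, hn⟩⟩
      obtain ⟨y, hy⟩ := exists_ne (0 : E n)
      have h0 : N sstar ^ p = 0 := by
        rw [hs, hN.map_zero, zero_pow (by omega)]
      have hg : gradient T sstar = 0 := by
        have h := upper (gradient T sstar)
        rw [h0, mul_zero, zero_mul] at h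
        rw [real_inner_self_eq_norm_sq] at h
        exact norm_eq_zero.1 (pow_eq_zero_iff two_ne_zero |>.1 (h.antisymm (sq_nonneg _)))
      exact ⟨(N y)⁻¹ • y, hN.map_inv_smul_self hy, by rw [h0, hg, inner_zero_left, mul_zero]⟩
    · have hpos := hN.pos hs
      have h := hmin.inner_gradient_add_nonneg hN hσ hd (d := -sstar) (b := -N sstar) (by
        filter_upwards [Ioo_mem_nhdsGT (zero_lt_one (α := ℝ))] with t ht
        have he : sstar + t • -sstar = (1 - t) • sstar := by module
        rw [he, hN.smul, abs_of_pos (sub_pos.2 ht.2)]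
        linarith)
      have h1 : N (-((N sstar)⁻¹ • sstar)) = 1 := by
        rw [hN.map_neg, hN.map_inv_smul_self hs]
      refine ⟨_, h1, le_antisymm ?_ ?_⟩
      · rw [← smul_neg, real_inner_smul_right, le_inv_mul_iff₀ hpos]
        linarith
      · simpa only [h1, mul_one] using upper (-((N sstar)⁻¹ • sstar))
  · rintro _ ⟨s, hs, rfl⟩
    simpa only [hs, mul_one] using upper s
end
end

section
/- Let p ≥ 1 be an integer and f : ℝ^n → ℝ be p times continuously differentiable with ‖∇^p f(x) − ∇^p f(y)‖_{N,p} ≤ L N(x − y) for all x, y ∈ ℝ^n, where L ≥ 0. Then for all x, s ∈ ℝ^n, ‖∇f(x+s) − ∇_s T_{f,p}(x,s)‖_{N,1} ≤ (L/p!) N(s)^p, where ∇_s T_{f,p}(x,s) denotes the gradient of the Taylor polynomial with respect to s. -/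
open scoped RealInnerProductSpace

noncomputable section

/-- The norm `‖S‖_{N,ℓ} := max_{N s = 1} |S[s,…,s]|` of an `ℓ`-linear form induced by `N`. -/
def tensorNorm (n p : ℕ) (N : E n → ℝ)
    (S : ContinuousMultilinearMap ℝ (fun _ : Fin p => E n) ℝ) : ℝ :=
  sSup {t : ℝ | ∃ s, N s = 1 ∧ t = |S (fun _ => s)|}

/-- The `p`-th order Taylor polynomial
`T_{f,p}(x,s) = f(x) + Σ_{ℓ=1}^p (1/ℓ!) ∇^ℓ f(x)[s]^ℓ`. -/
def Tay (n p : ℕ) (f : E n → ℝ) (x s : E n) : ℝ :=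
  f x + ∑ ℓ ∈ Finset.Icc 1 p, (1 / (ℓ.factorial : ℝ)) * iteratedFDeriv ℝ ℓ f x (fun _ => s)

lemma IsNorm.map_zero_s5 {n : ℕ} {N : E n → ℝ} (hN : IsNorm n N) : N 0 = 0 := by
  simpa using hN.smul 0 0

lemma IsNorm.nonneg_s5 {n : ℕ} {N : E n → ℝ} (hN : IsNorm n N) (x : E n) : 0 ≤ N x := by
  have h := hN.add_le x ((-1 : ℝ) • x)
  rw [hN.smul, neg_one_smul, add_neg_cancel, hN.map_zero_s5] at h
  norm_num at h
  linarith

lemma IsNorm.continuous {n : ℕ} {N : E n → ℝ} (hN : IsNorm n N) : Continuous N := by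
  have hconv : ConvexOn ℝ Set.univ N := by
    refine ⟨convex_univ, fun x _ y _ a b ha hb _ => ?_⟩
    have h := hN.add_le (a • x) (b • y)
    rwa [hN.smul, hN.smul, abs_of_nonneg ha, abs_of_nonneg hb] at h
  exact continuousOn_univ.1 (hconv.continuousOn isOpen_univ)

lemma IsNorm.exists_norm_le {n : ℕ} {N : E n → ℝ} (hN : IsNorm n N) :
    ∃ C : ℝ, ∀ s, N s = 1 → ‖s‖ ≤ C := by
  obtain ⟨c, hc, hle⟩ := (isCompact_sphere (0 : E n) 1).exists_forall_le'
    hN.continuous.continuousOn (a := 0) fun x hx =>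
      lt_of_le_of_ne (hN.nonneg_s5 x) fun h => by simp [hN.eq_zero x h.symm] at hx
  refine ⟨c⁻¹, fun s hs => ?_⟩
  have hs0 : 0 < ‖s‖ := by
    rw [norm_pos_iff]
    rintro rfl
    simp [hN.map_zero_s5] at hs
  have h := hle (‖s‖⁻¹ • s) (by simp [norm_smul, hs0.ne'])
  rw [hN.smul, hs, abs_of_pos (inv_pos.2 hs0), mul_one] at h
  exact (le_inv_comm₀ hc hs0).1 h

lemma IsNorm.abs_apply_le_tensorNorm {n p : ℕ} {N : E n → ℝ} (hN : IsNorm n N) (hp : p ≠ 0)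
    (S : ContinuousMultilinearMap ℝ (fun _ : Fin p => E n) ℝ) (s : E n) :
    |S fun _ => s| ≤ tensorNorm n p N S * N s ^ p := by
  have hbdd : BddAbove {t : ℝ | ∃ s, N s = 1 ∧ t = |S fun _ => s|} := by
    obtain ⟨C, hC⟩ := hN.exists_norm_le
    refine ⟨‖S‖ * C ^ p, ?_⟩
    rintro _ ⟨s, hs, rfl⟩
    calc |S fun _ => s| ≤ ‖S‖ * ∏ _i : Fin p, ‖s‖ := S.le_opNorm _
      _ ≤ ‖S‖ * C ^ p := by
        rw [Finset.prod_const, Finset.card_univ, Fintype.card_fin]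
        gcongr
        exact hC s hs
  rcases (hN.nonneg_s5 s).eq_or_lt with h | h
  · rw [S.map_coord_zero ⟨0, Nat.pos_of_ne_zero hp⟩ (hN.eq_zero s h.symm), ← h, zero_pow hp]
    simp
  · have hunit : N ((N s)⁻¹ • s) = 1 := by
      rw [hN.smul, abs_of_pos (inv_pos.2 h), inv_mul_cancel₀ h.ne']
    have hle : |S fun _ => (N s)⁻¹ • s| ≤ tensorNorm n p N S := le_csSup hbdd ⟨_, hunit, rfl⟩
    have hS : (S fun _ => s) = N s ^ p * S fun _ => (N s)⁻¹ • s := by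
      have := S.map_smul_univ (fun _ => N s) (fun _ => (N s)⁻¹ • s)
      simpa [smul_smul, h.ne'] using this
    rw [hS, abs_mul, abs_of_pos (pow_pos h p), mul_comm]
    gcongr

section Calculus

variable {V : Type*} [NormedAddCommGroup V] [NormedSpace ℝ V]

lemma iteratedFDeriv_update_const_eq_cons {f : V → ℝ} {k : ℕ} (hf : ContDiff ℝ (k + 1 : ℕ) f)
    (x s v : V) (i : Fin (k + 1)) :
    iteratedFDeriv ℝ (k + 1) f x (Function.update (fun _ => s) i v) =
      iteratedFDeriv ℝ (k + 1) f x (Fin.cons v fun _ => s) := by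
  induction k generalizing x with
  | zero =>
    congr 1
    ext j
    fin_cases i; fin_cases j; simp
  | succ k ih =>
    refine Fin.cases ?_ (fun j => ?_) i
    · congr 1
      ext j
      refine Fin.cases ?_ (fun l => ?_) j <;> simp
    have hd : ∀ y, DifferentiableAt ℝ (iteratedFDeriv ℝ (k + 1) f) y :=
      fun y => (hf.differentiable_iteratedFDeriv (by exact_mod_cast Nat.lt_succ_self _)) y
    have hd' : ∀ y, DifferentiableAt ℝ (iteratedFDeriv ℝ k f) y :=
      fun y => (hf.differentiable_iteratedFDeriv (by exact_mod_cast (by omega))) y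
    set g : V → ℝ := fun y => iteratedFDeriv ℝ k f y fun _ => s with hg
    have hgc : ContDiff ℝ 2 g := by
      have h1 : ContDiff ℝ 2 (iteratedFDeriv ℝ k f) :=
        hf.iteratedFDeriv_right (by norm_cast; omega)
      exact (ContinuousMultilinearMap.apply ℝ (fun _ : Fin k => V) ℝ fun _ => s).contDiff.comp h1
    have hsnd : ∀ a b : V, iteratedFDeriv ℝ (k + 2) f x (Fin.cons a (Fin.cons b fun _ => s)) =
        fderiv ℝ (fderiv ℝ g) x a b := by
      intro a b
      have h1 : ∀ y, iteratedFDeriv ℝ (k + 1) f y (Fin.cons b fun _ => s) = fderiv ℝ g y b :=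
        fun y => by rw [(hd' y).iteratedFDeriv_succ_apply_left']; simp [hg]
      rw [(hd x).iteratedFDeriv_succ_apply_left']
      simp only [Fin.tail_cons, Fin.cons_zero, h1]
      have hdg : DifferentiableAt ℝ (fderiv ℝ g) x :=
        ((hgc.fderiv_right (m := 1) (by norm_num)).differentiable (by norm_num)) x
      rw [fderiv_clm_apply hdg (differentiableAt_const b)]
      simp
    have hcons : (fun _ : Fin (k + 1) => s) = Fin.cons s fun _ => s := by
      ext j
      refine Fin.cases ?_ (fun l => ?_) j <;> simp
    have hcons' : Function.update (fun _ : Fin (k + 2) => s) j.succ v =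
        Fin.cons s (Function.update (fun _ => s) j v) := by
      rw [Fin.cons_update]
      congr 1
      ext j
      refine Fin.cases ?_ (fun l => ?_) j <;> simp
    have ih' := fun y => ih (hf.of_le (by exact_mod_cast Nat.le_succ _)) y j
    calc _ = iteratedFDeriv ℝ (k + 2) f x (Fin.cons s (Fin.cons v fun _ => s)) := by
            rw [hcons', (hd x).iteratedFDeriv_succ_apply_left',
              (hd x).iteratedFDeriv_succ_apply_left']
            simp only [Fin.tail_cons, Fin.cons_zero, ih']
      _ = iteratedFDeriv ℝ (k + 2) f x (Fin.cons v (Fin.cons s fun _ => s)) := by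
            rw [hsnd, hsnd]
            exact (hgc.contDiffAt.isSymmSndFDerivAt (by simp)).eq s v
      _ = _ := by rw [← hcons]

lemma hasDerivAt_iteratedFDeriv_diag {f : V → ℝ} {k : ℕ} (hf : ContDiff ℝ (k + 1 : ℕ) f)
    (x s v : V) :
    HasDerivAt (fun t : ℝ => iteratedFDeriv ℝ (k + 1) f x fun _ => s + t • v)
      ((k + 1) * iteratedFDeriv ℝ (k + 1) f x (Fin.cons v fun _ => s)) 0 := by
  have hline : HasDerivAt (fun t : ℝ => fun _ : Fin (k + 1) => s + t • v) (fun _ => v) 0 :=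
    hasDerivAt_pi.2 fun _ => by
      simpa using ((hasDerivAt_id (0 : ℝ)).smul_const v).const_add s
  have h := ((iteratedFDeriv ℝ (k + 1) f x).hasFDerivAt fun _ => s + (0 : ℝ) • v).comp_hasDerivAt
    (0 : ℝ) hline
  convert! h using 1
  simp [ContinuousMultilinearMap.linearDeriv_apply, iteratedFDeriv_update_const_eq_cons hf]

lemma hasDerivAt_iteratedFDeriv_base {f : V → ℝ} {k : ℕ} (hf : ContDiff ℝ (k + 1 : ℕ) f)
    (x s v : V) :
    HasDerivAt (fun t : ℝ => iteratedFDeriv ℝ k f (x + t • v) fun _ => s)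
      (iteratedFDeriv ℝ (k + 1) f x (Fin.cons v fun _ => s)) 0 := by
  have hd : DifferentiableAt ℝ (iteratedFDeriv ℝ k f) x :=
    (hf.differentiable_iteratedFDeriv (by exact_mod_cast Nat.lt_succ_self _)) x
  have hds : DifferentiableAt ℝ (fun y => iteratedFDeriv ℝ k f y fun _ => s) x :=
    hd.continuousMultilinear_apply_const _
  rw [hd.iteratedFDeriv_succ_apply_left']
  exact hds.hasFDerivAt.hasLineDerivAt v

lemma abs_sub_taylor_le {f : V → ℝ} {m : ℕ} (hf : ContDiff ℝ (m + 1 : ℕ) f) {s : V} {C : ℝ}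
    (hC : ∀ y, |iteratedFDeriv ℝ (m + 1) f y fun _ => s| ≤ C) (x : V) :
    |f (x + s) - ∑ k ∈ Finset.range (m + 1),
      (k.factorial : ℝ)⁻¹ * iteratedFDeriv ℝ k f x fun _ => s| ≤ C / (m + 1).factorial := by
  rw [map_add_eq_sum_add_integral_iteratedFDeriv (n := m) (f := f) (x := x) (y := s)
    fun t _ => hf.contDiffAt]
  simp only [smul_eq_mul, add_sub_cancel_left]
  have hint : |∫ t in (0 : ℝ)..1, (1 - t) ^ m * iteratedFDeriv ℝ (m + 1) f (x + t • s) fun _ => s|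
      ≤ ∫ t in (0 : ℝ)..1, (1 - t) ^ m * C := by
    have hcont : Continuous fun t : ℝ => (1 - t) ^ m * C := by fun_prop
    rw [← Real.norm_eq_abs]
    refine intervalIntegral.norm_integral_le_of_norm_le zero_le_one
      (Filter.Eventually.of_forall fun t ht => ?_) (hcont.intervalIntegrable _ _)
    have ht1 : 0 ≤ (1 - t) ^ m := pow_nonneg (sub_nonneg.2 ht.2) m
    rw [Real.norm_eq_abs, abs_mul, abs_of_nonneg ht1]
    gcongr
    exact hC _
  have hval : ∫ t in (0 : ℝ)..1, (1 - t) ^ m * C = C / (m + 1) := by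
    rw [intervalIntegral.integral_mul_const,
      intervalIntegral.integral_comp_sub_left (fun t : ℝ => t ^ m) 1]
    simp [integral_pow]
    ring
  rw [abs_mul, abs_of_nonneg (by positivity)]
  calc _ ≤ (m.factorial : ℝ)⁻¹ * (C / (m + 1)) := by
        rw [← hval]
        gcongr
    _ = C / (m + 1).factorial := by
        rw [Nat.factorial_succ]
        push_cast
        field_simp

end Calculus

lemma hasDerivAt_Tay {n m : ℕ} {f : E n → ℝ} (hf : ContDiff ℝ (m + 1 : ℕ) f) (x s v : E n) :
    HasDerivAt (fun t : ℝ => Tay n (m + 1) f x (s + t • v))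
      (∑ k ∈ Finset.range (m + 1),
        (k.factorial : ℝ)⁻¹ * iteratedFDeriv ℝ (k + 1) f x (Fin.cons v fun _ => s)) 0 := by
  have hT : ∀ t, Tay n (m + 1) f x t = f x + ∑ k ∈ Finset.range (m + 1),
      (1 / ((k + 1).factorial : ℝ)) * iteratedFDeriv ℝ (k + 1) f x fun _ => t := fun t => by
    rw [Tay, Finset.range_eq_Ico, Finset.sum_Ico_add' (fun k => (1 / (k.factorial : ℝ)) *
      iteratedFDeriv ℝ k f x fun _ => t) 0 (m + 1) 1]
    rfl
  simp only [hT]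
  refine HasDerivAt.const_add _ (HasDerivAt.fun_sum fun k hk => ?_)
  have hkm : k < m + 1 := Finset.mem_range.1 hk
  convert! (hasDerivAt_iteratedFDeriv_diag
    (hf.of_le (by exact_mod_cast hkm)) x s v).const_mul (1 / ((k + 1).factorial : ℝ)) using 1
  rw [Nat.factorial_succ]
  push_cast
  field_simp

lemma differentiable_Tay {n p : ℕ} (f : E n → ℝ) (x : E n) :
    Differentiable ℝ fun s => Tay n p f x s := by
  unfold Tay
  refine (differentiable_const _).add (Differentiable.fun_sum fun k _ => ?_)
  have hpi : Differentiable ℝ fun (s : E n) (_ : Fin k) => s :=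
    differentiable_pi.2 fun _ => differentiable_id
  have hS : Differentiable ℝ (iteratedFDeriv ℝ k f x) :=
    (iteratedFDeriv ℝ k f x).contDiff.differentiable (n := 1) one_ne_zero
  exact (hS.comp hpi).const_mul _

/-- Lipschitz error bound for gradients: if `∇^p f` is `L`-Lipschitz
w.r.t. `N` (in the induced tensor norm), then
`‖∇f(x+s) − ∇_s T_{f,p}(x,s)‖_{N,1} ≤ (L/p!) N(s)^p`. -/
theorem stmt5 {n : ℕ} (hn : 1 ≤ n) (N : E n → ℝ) (hN : IsNorm n N)
    (p : ℕ) (hp : 1 ≤ p) (f : E n → ℝ) (hf : ContDiff ℝ p f)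
    (L : ℝ) (hL : 0 ≤ L)
    (hLip : ∀ x y : E n,
      tensorNorm n p N (iteratedFDeriv ℝ p f x - iteratedFDeriv ℝ p f y) ≤ L * N (x - y)) :
    ∀ x s : E n,
      dualNorm n N (gradient f (x + s) - gradient (fun t => Tay n p f x t) s) ≤
        L / (p.factorial : ℝ) * N s ^ p := by
  intro x s
  obtain ⟨m, rfl⟩ : ∃ m, p = m + 1 := ⟨p - 1, by omega⟩
  have hNs := hN.nonneg_s5 s
  refine Real.sSup_le ?_ (by positivity)
  rintro _ ⟨v, hv, rfl⟩
  rw [inner_sub_left, inner_gradient_left, inner_gradient_left,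
    ← (differentiable_Tay f x s).lineDeriv_eq_fderiv]
  rw [lineDeriv, (hasDerivAt_Tay hf x s v).deriv]
  -- Taylor's theorem with increment `s` for the difference `f (· + w) - f` bounds the variation
  -- of the remainder with respect to the base point.
  set R : E n → ℝ := fun y => f (y + s) - ∑ k ∈ Finset.range (m + 1),
    (k.factorial : ℝ)⁻¹ * iteratedFDeriv ℝ k f y fun _ => s with hR
  have hRlip : ∀ w, |R (x + w) - R x| ≤ L * N w * N s ^ (m + 1) / (m + 1).factorial := by
    intro w
    have hfw : ContDiff ℝ (m + 1 : ℕ) fun y => f (y + w) := hf.comp (contDiff_id.add contDiff_const)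
    have hsub : ∀ k ≤ m + 1, ∀ y, iteratedFDeriv ℝ k (fun y => f (y + w) - f y) y =
        iteratedFDeriv ℝ k f (y + w) - iteratedFDeriv ℝ k f y := fun k hk y => by
      rw [fun_iteratedFDeriv_sub_apply (hfw.of_le (by exact_mod_cast hk)).contDiffAt
        (hf.of_le (by exact_mod_cast hk)).contDiffAt, iteratedFDeriv_comp_add_right]
    have h := abs_sub_taylor_le (hfw.sub hf) (s := s) (C := L * N w * N s ^ (m + 1)) (fun y => by
      rw [hsub _ le_rfl]
      refine (hN.abs_apply_le_tensorNorm m.succ_ne_zero _ s).trans ?_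
      gcongr
      simpa using hLip (y + w) y) x
    convert! h using 2
    rw [Finset.sum_congr rfl fun k hk => by rw [hsub k (Finset.mem_range.1 hk).le]]
    simp only [hR, sub_apply, mul_sub, Finset.sum_sub_distrib, add_right_comm x w s]
    ring
  have hfx : DifferentiableAt ℝ f (x + s) := hf.differentiable (by simp) _
  have hder : HasDerivAt (fun t : ℝ => R (x + t • v))
      (fderiv ℝ f (x + s) v - ∑ k ∈ Finset.range (m + 1),
        (k.factorial : ℝ)⁻¹ * iteratedFDeriv ℝ (k + 1) f x (Fin.cons v fun _ => s)) 0 := by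
    refine HasDerivAt.sub ?_ (HasDerivAt.fun_sum fun k hk => ?_)
    · simpa only [HasLineDerivAt, add_right_comm] using hfx.hasFDerivAt.hasLineDerivAt v
    · have hkm : k < m + 1 := Finset.mem_range.1 hk
      exact (hasDerivAt_iteratedFDeriv_base (hf.of_le (by exact_mod_cast hkm)) x s v).const_mul _
  refine (le_abs_self _).trans (hder.le_of_lip' (by positivity)
    (Filter.Eventually.of_forall fun t => ?_))
  have h := hRlip (t • v)
  rw [hN.smul, hv, mul_one] at h
  simp only [Real.norm_eq_abs, zero_smul, add_zero, sub_zero]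
  refine h.trans_eq ?_
  ring
end
end
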